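/- (Embedding theorem of Nazarov–Treil–Volberg.) Let μ be a locally finite Borel measure on ℝ^d, let 𝒟 be a finite collection of dyadic cubes, and let {β_Q}_{Q∈𝒟} be nonnegative real numbers. Define T(fμ) := {⟨f⟩^μ_Q 1_Q}_{Q∈𝒟}, so that |T(fμ)|_{ℓ^s(𝒟,β)} := (Σ_{Q∈𝒟} β_Q (⟨f⟩^μ_Q 1_Q)^s)^{1/s}. Then the following are equivalent: (i) T(·μ) : L^p(μ) → L^p_{ℓ^s(𝒟,β)}(μ) is bounded for all 1 < p, s < ∞; (ii) T(·μ) : L^{p₀}(μ) → L^{p₀}_{ℓ^{s₀}(𝒟,β)}(μ) is bounded for some 1 < p₀, s₀ < ∞; (iii) the direct testing constant 𝔗^{p₀}_{s₀} := sup_{R∈𝒟} ‖T_R(1μ)‖_{L^{p₀}_{ℓ^{s₀}(𝒟,β)}(μ)} / μ(R)^{1/p₀} is finite for some 1 < p₀, s₀ < ∞; (iv) the Carleson constant 𝔠 := sup_{R∈𝒟} μ(R)^{-1} Σ_{Q∈𝒟, Q⊆R} β_Q μ(Q) is finite. Quantitatively, ‖T(·μ)‖^s_{L^p(μ)→L^p_{ℓ^s(𝒟,β)}(μ)}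 ≤ C(p,s) 𝔠, 𝔠 ≤ C(s₀) (𝔗^{p₀}_{s₀})^{s₀}, and (𝔗^{p₀}_{s₀})^{s₀} ≤ ‖T(·μ)‖^{s₀}_{L^{s₀}(μ)→L^{s₀}_{ℓ^{s₀}(𝒟,β)}(μ)} when p₀ = s₀. -/

import Mathlib

open MeasureTheory ENNReal
open scoped Classical

/-- A dyadic cube `2^{-k}([0,1)^d + j)` in `ℝ^d`, encoded by its scale `k` and position `j`. -/
structure DCube (d : ℕ) where
  k : ℤ
  j : Fin d → ℤ
deriving DecidableEq

namespace DCube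
variable {d : ℕ}

/-- The dyadic cube as a subset of `ℝ^d`. -/
def toSet (Q : DCube d) : Set (Fin d → ℝ) :=
  {x | ∀ i, (2:ℝ) ^ (-Q.k) * Q.j i ≤ x i ∧ x i < (2:ℝ) ^ (-Q.k) * (Q.j i + 1)}

/-- The dyadic parent of a dyadic cube. -/
def parent (Q : DCube d) : DCube d := ⟨Q.k - 1, fun i => Int.fdiv (Q.j i) 2⟩

end DCube

/-- The `μ`-average `⟨f⟩^μ_Q` of a vector-valued function over a dyadic cube. -/
noncomputable def cubeAvg {d : ℕ} {E : Type*} [NormedAddCommGroup E] [NormedSpace ℝ E]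
    (μ : Measure (Fin d → ℝ)) (Q : DCube d) (f : (Fin d → ℝ) → E) : E :=
  (μ Q.toSet).toReal⁻¹ • ∫ x in Q.toSet, f x ∂μ

/-- The pointwise weighted `ℓ^s(𝒟,β)`-norm of `T(fμ) = {⟨f⟩^μ_Q 1_Q}_{Q ∈ 𝒟}`:
`|T(fμ)|_{ℓ^s(𝒟,β)}(x) = (Σ_{Q ∈ 𝒟} β_Q (⟨f⟩^μ_Q 1_Q(x))^s)^{1/s}`. -/
noncomputable def seqNormFn {d : ℕ} (𝒟 : Finset (DCube d)) (β : DCube d → ℝ) (s : ℝ)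
    (μ : Measure (Fin d → ℝ)) (f : (Fin d → ℝ) → ℝ) (x : Fin d → ℝ) : ℝ≥0∞ :=
  (∑ Q ∈ 𝒟, ENNReal.ofReal (β Q) *
      Q.toSet.indicator (fun _ => ENNReal.ofReal |cubeAvg μ Q f|) x ^ s) ^ (1 / s)

/-- The `L^p_{ℓ^s(𝒟,β)}(μ)`-norm of `T(fμ)`. -/
noncomputable def TLpNorm {d : ℕ} (𝒟 : Finset (DCube d)) (β : DCube d → ℝ) (p s : ℝ)
    (μ : Measure (Fin d → ℝ)) (f : (Fin d → ℝ) → ℝ) : ℝ≥0∞ :=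
  (∫⁻ x, seqNormFn 𝒟 β s μ f x ^ p ∂μ) ^ (1 / p)

/-- The Carleson constant `𝔠 = sup_{R ∈ 𝒟} μ(R)⁻¹ Σ_{Q ∈ 𝒟, Q ⊆ R} β_Q μ(Q)`. -/
noncomputable def carlConst {d : ℕ} (𝒟 : Finset (DCube d)) (β : DCube d → ℝ)
    (μ : Measure (Fin d → ℝ)) : ℝ≥0∞ :=
  ⨆ R ∈ 𝒟, (μ R.toSet)⁻¹ *
    ∑ Q ∈ 𝒟.filter (fun Q => Q.toSet ⊆ R.toSet), ENNReal.ofReal (β Q) * μ Q.toSet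

/-- The direct testing constant `𝔗^{p₀}_{s₀} = sup_{R ∈ 𝒟} ‖T_R(1μ)‖_{L^{p₀}_{ℓ^{s₀}}} / μ(R)^{1/p₀}`. -/
noncomputable def TtestConst {d : ℕ} (𝒟 : Finset (DCube d)) (β : DCube d → ℝ) (p₀ s₀ : ℝ)
    (μ : Measure (Fin d → ℝ)) : ℝ≥0∞ :=
  ⨆ R ∈ 𝒟, TLpNorm (𝒟.filter fun Q => Q.toSet ⊆ R.toSet) β p₀ s₀ μ (fun _ => 1) *
    μ R.toSet ^ (-(1 / p₀))

section NestedFamily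

variable {X ι : Type*}

/-- A family of sets in which any two members are nested or disjoint. -/
def NestedFamily (S : ι → Set X) : Prop :=
  ∀ Q R, S Q ⊆ S R ∨ S R ⊆ S Q ∨ Disjoint (S Q) (S R)

theorem NestedFamily.exists_disjoint_cover {S : ι → Set X} (hS : NestedFamily S)
    (𝒟 : Finset ι) :
    ∃ 𝓜 ⊆ 𝒟, (𝓜 : Set ι).PairwiseDisjoint S ∧ ∀ Q ∈ 𝒟, ∃ R ∈ 𝓜, S Q ⊆ S R := by
  induction 𝒟 using Finset.induction_on with
  | empty => exact ⟨∅, by simp⟩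
  | insert Q 𝒟 _ ih =>
    obtain ⟨𝓜, hsub, hdisj, hcov⟩ := ih
    by_cases h : ∃ R ∈ 𝓜, S Q ⊆ S R
    · refine ⟨𝓜, hsub.trans (Finset.subset_insert _ _), hdisj, fun P hP => ?_⟩
      rcases Finset.mem_insert.1 hP with rfl | hP
      exacts [h, hcov P hP]
    · push Not at h
      refine ⟨insert Q (𝓜.filter fun R => ¬ S R ⊆ S Q), ?_, ?_, fun P hP => ?_⟩
      · exact Finset.insert_subset_insert _ ((Finset.filter_subset _ _).trans hsub)
      · rw [Finset.coe_insert]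
        refine Set.PairwiseDisjoint.insert
          (hdisj.subset (Finset.coe_subset.2 (Finset.filter_subset _ _))) fun R hR _ => ?_
        obtain ⟨hR, hRQ⟩ := Finset.mem_filter.1 hR
        rcases hS Q R with h' | h' | h'
        exacts [absurd h' (h R hR), absurd h' hRQ, h']
      · rcases Finset.mem_insert.1 hP with rfl | hP
        · exact ⟨P, Finset.mem_insert_self _ _, subset_rfl⟩
        · obtain ⟨R, hR, hPR⟩ := hcov P hP
          by_cases hRQ : S R ⊆ S Q
          · exact ⟨Q, Finset.mem_insert_self _ _, hPR.trans hRQ⟩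
          · exact ⟨R, Finset.mem_insert_of_mem (Finset.mem_filter.2 ⟨hR, hRQ⟩), hPR⟩

/-- The maximal function `sup_{Q ∈ 𝒟} a_Q 1_Q`. -/
noncomputable def supIndicator (𝒟 : Finset ι) (S : ι → Set X) (a : ι → ℝ≥0∞) (x : X) : ℝ≥0∞ :=
  ⨆ Q ∈ 𝒟, (S Q).indicator (fun _ => a Q) x

theorem le_supIndicator {𝒟 : Finset ι} {S : ι → Set X} (a : ι → ℝ≥0∞) {Q : ι} (hQ : Q ∈ 𝒟)
    {x : X} (hx : x ∈ S Q) : a Q ≤ supIndicator 𝒟 S a x := by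
  have := le_iSup₂ (f := fun Q (_ : Q ∈ 𝒟) => (S Q).indicator (fun _ => a Q) x) Q hQ
  rwa [Set.indicator_of_mem hx] at this

theorem supIndicator_le {𝒟 : Finset ι} {S : ι → Set X} {a : ι → ℝ≥0∞} {x : X} {B : ℝ≥0∞}
    (h : ∀ Q ∈ 𝒟, x ∈ S Q → a Q ≤ B) : supIndicator 𝒟 S a x ≤ B :=
  iSup₂_le fun Q hQ => by
    by_cases hx : x ∈ S Q
    · simpa [hx] using h Q hQ hx
    · simp [hx]

theorem lt_supIndicator_iff {𝒟 : Finset ι} {S : ι → Set X} {a : ι → ℝ≥0∞} {t : ℝ≥0∞} {x : X} :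
    t < supIndicator 𝒟 S a x ↔ x ∈ ⋃ Q ∈ 𝒟.filter (fun Q => t < a Q), S Q := by
  simp only [supIndicator, lt_iSup_iff, Set.mem_iUnion, Finset.mem_filter, exists_prop, and_assoc]
  refine exists_congr fun Q => and_congr_right fun _ => ?_
  by_cases hx : x ∈ S Q <;> simp [hx]

theorem supIndicator_le_sum (𝒟 : Finset ι) (S : ι → Set X) (a : ι → ℝ≥0∞) (x : X) :
    supIndicator 𝒟 S a x ≤ ∑ Q ∈ 𝒟, (S Q).indicator (fun _ => a Q) x :=
  iSup₂_le fun _ hQ =>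
    Finset.single_le_sum (f := fun Q => (S Q).indicator (fun _ => a Q) x)
      (fun _ _ => zero_le) hQ

theorem sum_indicator_ne_top {𝒟 : Finset ι} (S : ι → Set X) {a : ι → ℝ≥0∞}
    (ha : ∀ Q ∈ 𝒟, a Q ≠ ⊤) (x : X) : ∑ Q ∈ 𝒟, (S Q).indicator (fun _ => a Q) x ≠ ⊤ := by
  refine ENNReal.sum_ne_top.2 fun Q hQ => ?_
  by_cases hx : x ∈ S Q <;> simp [hx, ha Q hQ]

theorem supIndicator_ne_top {𝒟 : Finset ι} (S : ι → Set X) {a : ι → ℝ≥0∞}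
    (ha : ∀ Q ∈ 𝒟, a Q ≠ ⊤) (x : X) : supIndicator 𝒟 S a x ≠ ⊤ :=
  ne_top_of_le_ne_top (sum_indicator_ne_top S ha x) (supIndicator_le_sum 𝒟 S a x)

variable [MeasurableSpace X] {μ ν : Measure X} {S : ι → Set X} {𝒟 : Finset ι}

theorem measurable_supIndicator (hm : ∀ Q, MeasurableSet (S Q)) (a : ι → ℝ≥0∞) :
    Measurable (supIndicator 𝒟 S a) :=
  Measurable.biSup _ 𝒟.countable_toSet fun Q _ => measurable_const.indicator (hm Q)

theorem measurable_sum_indicator (hm : ∀ Q, MeasurableSet (S Q)) (a : ι → ℝ≥0∞) :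
    Measurable fun x => ∑ Q ∈ 𝒟, (S Q).indicator (fun _ => a Q) x :=
  Finset.measurable_fun_sum _ fun Q _ => measurable_const.indicator (hm Q)

theorem lintegral_sum_indicator_rpow_ne_top (hm : ∀ Q, MeasurableSet (S Q))
    (hμ : ∀ Q, μ (S Q) ≠ ⊤) {a : ι → ℝ≥0∞} (ha : ∀ Q ∈ 𝒟, a Q ≠ ⊤) {q : ℝ} (hq : 0 < q) :
    ∫⁻ x, (∑ Q ∈ 𝒟, (S Q).indicator (fun _ => a Q) x) ^ q ∂μ ≠ ⊤ := by
  have hB : (∑ Q ∈ 𝒟, a Q) ^ q ≠ ⊤ :=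
    ENNReal.rpow_ne_top_of_nonneg hq.le (ENNReal.sum_ne_top.2 ha)
  have hU : μ (⋃ Q ∈ 𝒟, S Q) ≠ ⊤ :=
    ((measure_biUnion_finset_le _ _).trans_lt
      (ENNReal.sum_lt_top.2 fun Q _ => (hμ Q).lt_top)).ne
  refine ne_top_of_le_ne_top (ENNReal.mul_ne_top hB hU) ?_
  rw [← lintegral_indicator_const (Finset.measurableSet_biUnion _ fun Q _ => hm Q)]
  refine lintegral_mono fun x => ?_
  by_cases hx : x ∈ ⋃ Q ∈ 𝒟, S Q
  · rw [Set.indicator_of_mem hx]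
    gcongr
    exact Set.indicator_le_self _ _ _
  · rw [Finset.sum_eq_zero, ENNReal.zero_rpow_of_pos hq]
    · exact zero_le
    · intro Q hQ
      refine Set.indicator_of_notMem (fun h => hx ?_) _
      simp only [Set.mem_iUnion]
      exact ⟨Q, hQ, h⟩

theorem lintegral_supIndicator_rpow_ne_top (hm : ∀ Q, MeasurableSet (S Q))
    (hμ : ∀ Q, μ (S Q) ≠ ⊤) {a : ι → ℝ≥0∞} (ha : ∀ Q ∈ 𝒟, a Q ≠ ⊤) {q : ℝ} (hq : 0 < q) :
    ∫⁻ x, supIndicator 𝒟 S a x ^ q ∂μ ≠ ⊤ := by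
  refine ne_top_of_le_ne_top (lintegral_sum_indicator_rpow_ne_top hm hμ ha hq)
    (lintegral_mono fun x => ?_)
  gcongr
  exact supIndicator_le_sum 𝒟 S a x

theorem NestedFamily.mul_measure_biUnion_le (hS : NestedFamily S)
    (hm : ∀ Q, MeasurableSet (S Q)) {t : ℝ≥0∞} (h : ∀ Q ∈ 𝒟, t * μ (S Q) ≤ ν (S Q)) :
    t * μ (⋃ Q ∈ 𝒟, S Q) ≤ ν (⋃ Q ∈ 𝒟, S Q) := by
  obtain ⟨𝓜, hsub, hdisj, hcov⟩ := hS.exists_disjoint_cover 𝒟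
  have hU : (⋃ Q ∈ 𝒟, S Q) = ⋃ Q ∈ 𝓜, S Q := by
    refine subset_antisymm (Set.iUnion₂_subset fun Q hQ => ?_)
      (Set.biUnion_subset_biUnion_left hsub)
    obtain ⟨R, hR, hQR⟩ := hcov Q hQ
    exact hQR.trans (Set.subset_biUnion_of_mem (u := S) hR)
  rw [hU, measure_biUnion_finset hdisj fun Q _ => hm Q,
    measure_biUnion_finset hdisj fun Q _ => hm Q, Finset.mul_sum]
  exact Finset.sum_le_sum fun Q hQ => h Q (hsub hQ)

/-- The weights `w` satisfy a Carleson condition with respect to the measure `ν`. -/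
def CarlesonWeight (𝒟 : Finset ι) (S : ι → Set X) (ν : Measure X) (w : ι → ℝ≥0∞) : Prop :=
  ∀ R ∈ 𝒟, ∑ Q ∈ 𝒟.filter (fun Q => S Q ⊆ S R), w Q ≤ ν (S R)

theorem NestedFamily.sum_le_measure_biUnion (hS : NestedFamily S)
    (hm : ∀ Q, MeasurableSet (S Q)) {w : ι → ℝ≥0∞} (h : CarlesonWeight 𝒟 S ν w)
    {𝒮 : Finset ι} (h𝒮 : 𝒮 ⊆ 𝒟) : ∑ Q ∈ 𝒮, w Q ≤ ν (⋃ Q ∈ 𝒮, S Q) := by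
  obtain ⟨𝓜, hsub, hdisj, hcov⟩ := hS.exists_disjoint_cover 𝒮
  calc ∑ Q ∈ 𝒮, w Q
      ≤ ∑ Q ∈ 𝒮, ∑ R ∈ 𝓜, if S Q ⊆ S R then w Q else 0 := by
        refine Finset.sum_le_sum fun Q hQ => ?_
        obtain ⟨R, hR, hQR⟩ := hcov Q hQ
        refine le_trans ?_ (Finset.single_le_sum
          (f := fun R => if S Q ⊆ S R then w Q else 0) (fun _ _ => zero_le) hR)
        simp [hQR]
    _ = ∑ R ∈ 𝓜, ∑ Q ∈ 𝒮.filter (fun Q => S Q ⊆ S R), w Q := by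
        rw [Finset.sum_comm]
        simp only [Finset.sum_filter]
    _ ≤ ∑ R ∈ 𝓜, ∑ Q ∈ 𝒟.filter (fun Q => S Q ⊆ S R), w Q :=
        Finset.sum_le_sum fun R _ =>
          Finset.sum_le_sum_of_subset (Finset.filter_subset_filter _ h𝒮)
    _ ≤ ∑ R ∈ 𝓜, ν (S R) := Finset.sum_le_sum fun R hR => h R (h𝒮 (hsub hR))
    _ = ν (⋃ R ∈ 𝓜, S R) := (measure_biUnion_finset hdisj fun Q _ => hm Q).symm
    _ ≤ ν (⋃ Q ∈ 𝒮, S Q) := measure_mono (Set.biUnion_subset_biUnion_left hsub)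

/-- Carleson embedding: a Carleson sequence integrates `b` at most as much as `ν` integrates
the maximal function of `b`. -/
theorem NestedFamily.sum_mul_le_lintegral_supIndicator (hS : NestedFamily S)
    (hm : ∀ Q, MeasurableSet (S Q)) {w : ι → ℝ≥0∞} (h : CarlesonWeight 𝒟 S ν w)
    {b : ι → ℝ≥0∞} (hb : ∀ Q ∈ 𝒟, b Q ≠ ⊤) :
    ∑ Q ∈ 𝒟, w Q * b Q ≤ ∫⁻ x, supIndicator 𝒟 S b x ∂ν := by
  let _ : MeasurableSpace ι := ⊤
  set ω : Measure ι := ∑ Q ∈ 𝒟, w Q • Measure.dirac Q with hω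
  have hωint : ∀ f : ι → ℝ≥0∞, ∫⁻ Q, f Q ∂ω = ∑ Q ∈ 𝒟, w Q * f Q := fun f => by
    simp [hω, lintegral_finsetSum_measure, lintegral_smul_measure, lintegral_dirac]
  have h1 : ∑ Q ∈ 𝒟, w Q * b Q = ∫⁻ Q, ENNReal.ofReal (b Q).toReal ∂ω := by
    rw [hωint]
    exact Finset.sum_congr rfl fun Q hQ => by rw [ENNReal.ofReal_toReal (hb Q hQ)]
  have h2 : ∫⁻ x, supIndicator 𝒟 S b x ∂ν
      = ∫⁻ x, ENNReal.ofReal (supIndicator 𝒟 S b x).toReal ∂ν :=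
    lintegral_congr fun x => (ENNReal.ofReal_toReal (supIndicator_ne_top S hb x)).symm
  rw [h1, h2, lintegral_eq_lintegral_meas_lt ω (.of_forall fun _ => ENNReal.toReal_nonneg)
    (measurable_from_top.aemeasurable), lintegral_eq_lintegral_meas_lt ν
    (.of_forall fun _ => ENNReal.toReal_nonneg)
    (measurable_supIndicator hm b).ennreal_toReal.aemeasurable]
  refine setLIntegral_mono' measurableSet_Ioi fun t (ht : 0 < t) => ?_
  have h3 : {x | t < (supIndicator 𝒟 S b x).toReal}
      = ⋃ Q ∈ 𝒟.filter (fun Q => ENNReal.ofReal t < b Q), S Q := by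
    ext x
    rw [Set.mem_ofPred_eq, ← lt_supIndicator_iff,
      ENNReal.ofReal_lt_iff_lt_toReal ht.le (supIndicator_ne_top S hb x)]
  rw [h3]
  refine le_trans (le_of_eq ?_)
    (hS.sum_le_measure_biUnion hm h (Finset.filter_subset (fun Q => ENNReal.ofReal t < b Q) 𝒟))
  rw [← lintegral_indicator_one MeasurableSpace.measurableSet_top, hωint, Finset.sum_filter]
  refine Finset.sum_congr rfl fun Q hQ => ?_
  have := ENNReal.ofReal_lt_iff_lt_toReal ht.le (hb Q hQ)
  by_cases hlt : t < (b Q).toReal <;> simp [Set.indicator, this, hlt]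

theorem lintegral_rpow_le_of_weak_type {f : X → ℝ≥0∞} (hf : Measurable f) (hfin : ∀ x, f x ≠ ⊤)
    (h : ∀ t : ℝ, 0 < t →
      ENNReal.ofReal t * μ {x | ENNReal.ofReal t < f x} ≤ ν {x | ENNReal.ofReal t < f x})
    {p : ℝ} (hp : 1 < p) :
    ∫⁻ x, f x ^ p ∂μ ≤ ENNReal.ofReal (p / (p - 1)) * ∫⁻ x, f x ^ (p - 1) ∂ν := by
  have hp0 : 0 < p - 1 := sub_pos.2 hp
  have key : ∀ (r : ℝ), 0 < r → ∀ m : Measure X, ∫⁻ x, f x ^ r ∂m = ENNReal.ofReal r *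
      ∫⁻ t in Set.Ioi (0:ℝ), m {x | ENNReal.ofReal t < f x} * ENNReal.ofReal (t ^ (r - 1)) := by
    intro r hr m
    have h1 : ∫⁻ x, f x ^ r ∂m = ∫⁻ x, ENNReal.ofReal ((f x).toReal ^ r) ∂m := by
      refine lintegral_congr fun x => ?_
      rw [← ENNReal.ofReal_rpow_of_nonneg ENNReal.toReal_nonneg hr.le,
        ENNReal.ofReal_toReal (hfin x)]
    rw [h1, lintegral_rpow_eq_lintegral_meas_lt_mul m
      (.of_forall fun _ => ENNReal.toReal_nonneg) hf.ennreal_toReal.aemeasurable hr]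
    congr 1
    refine setLIntegral_congr_fun measurableSet_Ioi fun t (ht : 0 < t) => ?_
    simp only [ENNReal.ofReal_lt_iff_lt_toReal ht.le (hfin _)]
  rw [key p (by linarith) μ, key (p - 1) hp0 ν, ← mul_assoc,
    ← ENNReal.ofReal_mul (by positivity), div_mul_cancel₀ _ hp0.ne']
  refine mul_le_mul_right ?_ _
  refine setLIntegral_mono' measurableSet_Ioi fun t (ht : 0 < t) => ?_
  have : t ^ (p - 1) = t * t ^ (p - 1 - 1) := by
    rw [Real.rpow_sub_one ht.ne' (p - 1)]; field_simp
  rw [this, ENNReal.ofReal_mul ht.le, ← mul_assoc, mul_comm (μ _)]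
  gcongr
  exact h t ht

theorem ENNReal.le_rpow_of_le_mul_rpow_one_div {x y : ℝ≥0∞} {p q : ℝ} (hpq : p.HolderConjugate q)
    (hx : x ≠ ⊤) (h : x ≤ y * x ^ (1 / q)) : x ≤ y ^ p := by
  rcases eq_or_ne x 0 with rfl | hx0
  · exact zero_le
  have h1 : x ^ (1 / p) * x ^ (1 / q) = x := by
    rw [← ENNReal.rpow_add _ _ hx0 hx, one_div, one_div, hpq.inv_add_inv_eq_one,
      ENNReal.rpow_one]
  have h2 : x ^ (1 / p) ≤ y := by
    refine (ENNReal.mul_le_mul_iff_left (c := x ^ (1 / q)) ?_ ?_).1 (h1.le.trans h)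
    · simp [hx0, hx]
    · exact ENNReal.rpow_ne_top_of_nonneg (one_div_nonneg.2 hpq.symm.nonneg) hx
  rwa [one_div, ENNReal.rpow_inv_le_iff hpq.pos] at h2

/-- The average of a nonnegative function over a set. -/
noncomputable def setLAvg (μ : Measure X) (g : X → ℝ≥0∞) (s : Set X) : ℝ≥0∞ :=
  (μ s)⁻¹ * ∫⁻ x in s, g x ∂μ

theorem setLAvg_mul_measure {g : X → ℝ≥0∞} {s : Set X} (hs : μ s ≠ ⊤) :
    setLAvg μ g s * μ s = ∫⁻ x in s, g x ∂μ := by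
  rcases eq_or_ne (μ s) 0 with h0 | h0
  · simp [h0, setLIntegral_measure_zero _ _ h0]
  · rw [setLAvg, mul_right_comm, ENNReal.inv_mul_cancel h0 hs, one_mul]

theorem setLAvg_ne_top {g : X → ℝ≥0∞} {s : Set X} (hs : μ s ≠ ⊤) {p : ℝ} (hp : 1 < p)
    (hg : ∫⁻ x, g x ^ p ∂μ ≠ ⊤) : setLAvg μ g s ≠ ⊤ := by
  rcases eq_or_ne (μ s) 0 with h0 | h0
  · simp [setLAvg, setLIntegral_measure_zero _ _ h0]
  refine ENNReal.mul_ne_top (ENNReal.inv_ne_top.2 h0) ?_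
  have hle : ∫⁻ x in s, g x ∂μ ≤ ∫⁻ x in s, (1 + g x ^ p) ∂μ := by
    refine lintegral_mono fun x => ?_
    rcases le_total (g x) 1 with h | h
    · exact h.trans le_self_add
    · exact (ENNReal.le_rpow_self_of_one_le h hp.le).trans le_add_self
  refine ne_top_of_le_ne_top ?_ hle
  rw [lintegral_add_left measurable_const]
  simp only [lintegral_const, Measure.restrict_apply_univ, one_mul]
  exact ENNReal.add_ne_top.2 ⟨hs, ne_top_of_le_ne_top hg (setLIntegral_le_lintegral _ _)⟩

/-- The strong-type bound for the maximal function of a finite nested family. -/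
theorem NestedFamily.lintegral_maximal_rpow_le (hS : NestedFamily S)
    (hm : ∀ Q, MeasurableSet (S Q)) (hμ : ∀ Q, μ (S Q) ≠ ⊤) {g : X → ℝ≥0∞} (hg : Measurable g)
    {p : ℝ} (hp : 1 < p) (hgp : ∫⁻ x, g x ^ p ∂μ ≠ ⊤) :
    ∫⁻ x, supIndicator 𝒟 S (fun Q => setLAvg μ g (S Q)) x ^ p ∂μ
      ≤ ENNReal.ofReal (p / (p - 1)) ^ p * ∫⁻ x, g x ^ p ∂μ := by
  set M := supIndicator 𝒟 S (fun Q => setLAvg μ g (S Q)) with hM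
  have hpq := Real.HolderConjugate.conjExponent hp
  have hA : ∀ Q ∈ 𝒟, setLAvg μ g (S Q) ≠ ⊤ := fun Q _ => setLAvg_ne_top (hμ Q) hp hgp
  have hMm : Measurable M := measurable_supIndicator hm _
  have h1 : ∫⁻ x, M x ^ p ∂μ
      ≤ ENNReal.ofReal (p / (p - 1)) * ∫⁻ x, M x ^ (p - 1) ∂(μ.withDensity g) := by
    refine lintegral_rpow_le_of_weak_type hMm (supIndicator_ne_top S hA) (fun t _ => ?_) hp
    have : {x | ENNReal.ofReal t < M x}
        = ⋃ Q ∈ 𝒟.filter (fun Q => ENNReal.ofReal t < setLAvg μ g (S Q)), S Q := by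
      ext x
      rw [Set.mem_ofPred_eq, hM, lt_supIndicator_iff]
    rw [this]
    refine hS.mul_measure_biUnion_le hm fun Q hQ => ?_
    rw [withDensity_apply _ (hm Q), ← setLAvg_mul_measure (hμ Q)]
    gcongr
    exact (Finset.mem_filter.1 hQ).2.le
  rw [lintegral_withDensity_eq_lintegral_mul _ hg (hMm.pow_const _)] at h1
  have h2 := ENNReal.lintegral_mul_le_Lp_mul_Lq μ hpq hg.aemeasurable
    (hMm.pow_const (p - 1)).aemeasurable
  simp only [← ENNReal.rpow_mul, hpq.sub_one_mul_conj] at h2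
  have h3 := ENNReal.le_rpow_of_le_mul_rpow_one_div hpq
    (lintegral_supIndicator_rpow_ne_top hm hμ hA (by linarith))
    ((h1.trans (mul_le_mul_right h2 _)).trans_eq (mul_assoc _ _ _).symm)
  refine h3.trans_eq ?_
  rw [ENNReal.mul_rpow_of_nonneg _ _ (by linarith), ← ENNReal.rpow_mul,
    one_div_mul_cancel (by linarith), ENNReal.rpow_one]

theorem lintegral_sum_indicator (hm : ∀ Q, MeasurableSet (S Q)) (a : ι → ℝ≥0∞) :
    ∫⁻ x, ∑ Q ∈ 𝒟, (S Q).indicator (fun _ => a Q) x ∂μ = ∑ Q ∈ 𝒟, a Q * μ (S Q) := by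
  rw [lintegral_finsetSum _ fun Q _ => measurable_const.indicator (hm Q)]
  simp only [lintegral_indicator_const (hm _)]

/-- The `p`-th power of the norm of the maximal operator on `L^p`. -/
noncomputable def maximalConst (p : ℝ) : ℝ≥0∞ := ENNReal.ofReal (p / (p - 1)) ^ p

theorem maximalConst_ne_top {p : ℝ} (hp : 1 < p) : maximalConst p ≠ ⊤ :=
  ENNReal.rpow_ne_top_of_nonneg (by linarith) ENNReal.ofReal_ne_top

theorem NestedFamily.lintegral_rpow_le_of_le (hS : NestedFamily S)
    (hm : ∀ Q, MeasurableSet (S Q)) (hμ : ∀ Q, μ (S Q) ≠ ⊤) {b : ι → ℝ≥0∞} {c : ℝ≥0∞}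
    (hc : CarlesonWeight 𝒟 S (c • μ) fun Q => b Q * μ (S Q)) {g : X → ℝ≥0∞} (hg : Measurable g)
    {p s : ℝ} (hp : 1 < p) (hps : p ≤ s) (hgp : ∫⁻ x, g x ^ p ∂μ ≠ ⊤) :
    ∫⁻ x, (∑ Q ∈ 𝒟, (S Q).indicator (fun _ => b Q * setLAvg μ g (S Q) ^ s) x) ^ (p / s) ∂μ
      ≤ maximalConst p * c ^ (p / s) * ∫⁻ x, g x ^ p ∂μ := by
  have hp0 : 0 < p := by linarith
  have hs0 : 0 < s := by linarith
  have hr : 0 ≤ 1 - p / s := sub_nonneg.2 ((div_le_one hs0).2 hps)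
  have hr' : 0 ≤ p / s := by positivity
  set A : ι → ℝ≥0∞ := fun Q => setLAvg μ g (S Q) with hAdef
  set M := supIndicator 𝒟 S A with hM
  set G := ∫⁻ x, g x ^ p ∂μ
  have hA : ∀ Q ∈ 𝒟, A Q ≠ ⊤ := fun Q _ => setLAvg_ne_top (hμ Q) hp hgp
  have hMp : ∫⁻ x, M x ^ p ∂μ ≤ maximalConst p * G :=
    hS.lintegral_maximal_rpow_le hm hμ hg hp hgp
  have hpt : ∀ x, (∑ Q ∈ 𝒟, (S Q).indicator (fun _ => b Q * A Q ^ s) x) ^ (p / s)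
      ≤ (M x ^ p) ^ (1 - p / s)
        * (∑ Q ∈ 𝒟, (S Q).indicator (fun _ => b Q * A Q ^ p) x) ^ (p / s) := by
    intro x
    have h1 : ∑ Q ∈ 𝒟, (S Q).indicator (fun _ => b Q * A Q ^ s) x
        ≤ M x ^ (s - p) * ∑ Q ∈ 𝒟, (S Q).indicator (fun _ => b Q * A Q ^ p) x := by
      rw [Finset.mul_sum]
      refine Finset.sum_le_sum fun Q hQ => ?_
      by_cases hx : x ∈ S Q
      · rw [Set.indicator_of_mem hx, Set.indicator_of_mem hx, mul_left_comm]
        refine mul_le_mul_right ?_ _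
        calc A Q ^ s = A Q ^ (s - p) * A Q ^ p := by
              rw [← ENNReal.rpow_add_of_nonneg _ _ (by linarith) hp0.le, sub_add_cancel]
          _ ≤ M x ^ (s - p) * A Q ^ p := by
              refine mul_le_mul_left (ENNReal.rpow_le_rpow ?_ (by linarith)) _
              exact le_supIndicator A hQ hx
      · simp [hx]
    refine (ENNReal.rpow_le_rpow h1 hr').trans_eq ?_
    rw [ENNReal.mul_rpow_of_nonneg _ _ hr', ← ENNReal.rpow_mul, ← ENNReal.rpow_mul]
    congr 2
    field_simp
  have hsum : ∫⁻ x, ∑ Q ∈ 𝒟, (S Q).indicator (fun _ => b Q * A Q ^ p) x ∂μ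
      ≤ c * (maximalConst p * G) := by
    rw [lintegral_sum_indicator hm]
    calc ∑ Q ∈ 𝒟, b Q * A Q ^ p * μ (S Q) = ∑ Q ∈ 𝒟, b Q * μ (S Q) * A Q ^ p :=
          Finset.sum_congr rfl fun Q _ => mul_right_comm _ _ _
      _ ≤ ∫⁻ x, supIndicator 𝒟 S (fun Q => A Q ^ p) x ∂(c • μ) :=
          hS.sum_mul_le_lintegral_supIndicator hm hc
            fun Q hQ => ENNReal.rpow_ne_top_of_nonneg hp0.le (hA Q hQ)
      _ = c * ∫⁻ x, supIndicator 𝒟 S (fun Q => A Q ^ p) x ∂μ := by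
          rw [lintegral_smul_measure, smul_eq_mul]
      _ ≤ c * ∫⁻ x, M x ^ p ∂μ := by
          refine mul_le_mul_right (lintegral_mono fun x => supIndicator_le fun Q hQ hx => ?_) _
          exact ENNReal.rpow_le_rpow (le_supIndicator A hQ hx) hp0.le
      _ ≤ c * (maximalConst p * G) := mul_le_mul_right hMp _
  calc _ ≤ ∫⁻ x, (M x ^ p) ^ (1 - p / s)
        * (∑ Q ∈ 𝒟, (S Q).indicator (fun _ => b Q * A Q ^ p) x) ^ (p / s) ∂μ :=
        lintegral_mono hpt
    _ ≤ (∫⁻ x, M x ^ p ∂μ) ^ (1 - p / s)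
        * (∫⁻ x, ∑ Q ∈ 𝒟, (S Q).indicator (fun _ => b Q * A Q ^ p) x ∂μ) ^ (p / s) :=
        ENNReal.lintegral_mul_norm_pow_le
          ((measurable_supIndicator hm A).pow_const p).aemeasurable
          (measurable_sum_indicator hm _).aemeasurable hr hr' (by ring)
    _ ≤ (maximalConst p * G) ^ (1 - p / s) * (c * (maximalConst p * G)) ^ (p / s) := by gcongr
    _ = maximalConst p * c ^ (p / s) * G := by
        rw [ENNReal.mul_rpow_of_nonneg c _ hr', mul_left_comm,
          ← ENNReal.rpow_add_of_nonneg _ _ hr hr', sub_add_cancel, ENNReal.rpow_one]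
        ring

theorem NestedFamily.lintegral_rpow_le_of_lt (hS : NestedFamily S)
    (hm : ∀ Q, MeasurableSet (S Q)) (hμ : ∀ Q, μ (S Q) ≠ ⊤) {b : ι → ℝ≥0∞}
    (hb : ∀ Q, b Q ≠ ⊤) {c : ℝ≥0∞}
    (hc : CarlesonWeight 𝒟 S (c • μ) fun Q => b Q * μ (S Q)) {g : X → ℝ≥0∞} (hg : Measurable g)
    {p s : ℝ} (hs : 1 < s) (hsp : s < p) (hgp : ∫⁻ x, g x ^ p ∂μ ≠ ⊤) :
    ∫⁻ x, (∑ Q ∈ 𝒟, (S Q).indicator (fun _ => b Q * setLAvg μ g (S Q) ^ s) x) ^ (p / s) ∂μ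
      ≤ maximalConst p * maximalConst (p / s).conjExponent ^ ((p / s) / (p / s).conjExponent)
        * c ^ (p / s) * ∫⁻ x, g x ^ p ∂μ := by
  have hp : 1 < p := hs.trans hsp
  have hs0 : 0 < s := by linarith
  set q := p / s with hq
  have hq1 : 1 < q := (one_lt_div hs0).2 hsp
  have hqq := Real.HolderConjugate.conjExponent hq1
  set q' := q.conjExponent
  set A : ι → ℝ≥0∞ := fun Q => setLAvg μ g (S Q) with hAdef
  set G := ∫⁻ x, g x ^ p ∂μ
  have hA : ∀ Q ∈ 𝒟, A Q ≠ ⊤ := fun Q _ => setLAvg_ne_top (hμ Q) hp hgp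
  have hAs : ∀ Q ∈ 𝒟, A Q ^ s ≠ ⊤ := fun Q hQ => ENNReal.rpow_ne_top_of_nonneg hs0.le (hA Q hQ)
  set F : X → ℝ≥0∞ := fun x => ∑ Q ∈ 𝒟, (S Q).indicator (fun _ => b Q * A Q ^ s) x with hF
  have hFm : Measurable F := measurable_sum_indicator hm _
  have hFX : ∫⁻ x, F x ^ q ∂μ ≠ ⊤ := lintegral_sum_indicator_rpow_ne_top hm hμ
    (fun Q hQ => ENNReal.mul_ne_top (hb Q) (hAs Q hQ)) hqq.pos
  set h : X → ℝ≥0∞ := fun x => F x ^ (q - 1) with hh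
  have hhm : Measurable h := hFm.pow_const _
  have hhq : ∀ x, h x ^ q' = F x ^ q := fun x => by
    rw [hh, ← ENNReal.rpow_mul, hqq.sub_one_mul_conj]
  have hhX : ∫⁻ x, h x ^ q' ∂μ ≠ ⊤ := by simpa only [hhq] using hFX
  set H : ι → ℝ≥0∞ := fun Q => setLAvg μ h (S Q)
  have hH : ∀ Q ∈ 𝒟, H Q ≠ ⊤ := fun Q _ => setLAvg_ne_top (hμ Q) hqq.symm.lt hhX
  have hMA := hS.lintegral_maximal_rpow_le (𝒟 := 𝒟) hm hμ hg hp hgp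
  have hMH := hS.lintegral_maximal_rpow_le (𝒟 := 𝒟) hm hμ hhm hqq.symm.lt hhX
  simp only [hhq] at hMH
  have hdual : ∫⁻ x, F x ^ q ∂μ = ∑ Q ∈ 𝒟, b Q * μ (S Q) * (A Q ^ s * H Q) := by
    have h1 : ∀ x, F x ^ q
        = ∑ Q ∈ 𝒟, (S Q).indicator (fun x => b Q * A Q ^ s * h x) x := by
      intro x
      have : F x ^ q = F x * h x := by
        calc F x ^ q = F x ^ (1 + (q - 1)) := by rw [add_sub_cancel]
          _ = F x * h x := by
            rw [ENNReal.rpow_add_of_nonneg _ _ zero_le_one (by linarith), ENNReal.rpow_one]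
      rw [this, hF, Finset.sum_mul]
      refine Finset.sum_congr rfl fun Q _ => ?_
      by_cases hx : x ∈ S Q <;> simp [hx]
    simp only [h1]
    rw [lintegral_finsetSum _ fun Q _ => (hhm.const_mul _).indicator (hm Q)]
    refine Finset.sum_congr rfl fun Q _ => ?_
    rw [lintegral_indicator (hm Q), lintegral_const_mul _ hhm, ← setLAvg_mul_measure (hμ Q)]
    ring
  have hle : ∫⁻ x, F x ^ q ∂μ ≤ c * ((maximalConst p * G) ^ (1 / q)
      * (maximalConst q' * ∫⁻ x, F x ^ q ∂μ) ^ (1 / q')) := by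
    calc ∫⁻ x, F x ^ q ∂μ
        ≤ ∫⁻ x, supIndicator 𝒟 S (fun Q => A Q ^ s * H Q) x ∂(c • μ) :=
          hdual.trans_le (hS.sum_mul_le_lintegral_supIndicator hm hc
            fun Q hQ => ENNReal.mul_ne_top (hAs Q hQ) (hH Q hQ))
      _ = c * ∫⁻ x, supIndicator 𝒟 S (fun Q => A Q ^ s * H Q) x ∂μ := by
          rw [lintegral_smul_measure, smul_eq_mul]
      _ ≤ c * ∫⁻ x, ((fun x => supIndicator 𝒟 S A x ^ s) * supIndicator 𝒟 S H) x ∂μ := by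
          refine mul_le_mul_right (lintegral_mono fun x => supIndicator_le fun Q hQ hx => ?_) _
          exact mul_le_mul' (ENNReal.rpow_le_rpow (le_supIndicator A hQ hx) hs0.le)
            (le_supIndicator H hQ hx)
      _ ≤ c * ((∫⁻ x, (supIndicator 𝒟 S A x ^ s) ^ q ∂μ) ^ (1 / q)
            * (∫⁻ x, supIndicator 𝒟 S H x ^ q' ∂μ) ^ (1 / q')) :=
          mul_le_mul_right (ENNReal.lintegral_mul_le_Lp_mul_Lq μ hqq
            ((measurable_supIndicator hm A).pow_const s).aemeasurable
            (measurable_supIndicator hm H).aemeasurable) _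
      _ ≤ _ := by
          have hsq : s * q = p := by rw [hq]; field_simp
          simp only [← ENNReal.rpow_mul, hsq]
          have := hqq.pos
          have := hqq.symm.pos
          gcongr <;> assumption
  have hqn := hqq.nonneg
  have hqn' := hqq.symm.nonneg
  rw [ENNReal.mul_rpow_of_nonneg (maximalConst q') _ (by positivity), ← mul_assoc,
    ← mul_assoc] at hle
  refine (ENNReal.le_rpow_of_le_mul_rpow_one_div hqq hFX hle).trans_eq ?_
  simp only [ENNReal.mul_rpow_of_nonneg _ _ hqn, ← ENNReal.rpow_mul,
    ENNReal.mul_rpow_of_nonneg _ _ (one_div_nonneg.2 hqn), one_div_mul_cancel hqq.ne_zero,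
    ENNReal.rpow_one, one_div_mul_eq_div]
  ring

/-- The constant in the embedding theorem, as a function of the exponents. -/
noncomputable def embeddingConst (p s : ℝ) : ℝ≥0∞ :=
  if p ≤ s then maximalConst p
  else maximalConst p * maximalConst (p / s).conjExponent ^ ((p / s) / (p / s).conjExponent)

theorem embeddingConst_ne_top {p s : ℝ} (hp : 1 < p) (hs : 1 < s) : embeddingConst p s ≠ ⊤ := by
  rw [embeddingConst]
  split_ifs with hps
  · exact maximalConst_ne_top hp
  · have hqq := Real.HolderConjugate.conjExponent
      ((one_lt_div (by linarith)).2 (not_le.1 hps) : 1 < p / s)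
    exact ENNReal.mul_ne_top (maximalConst_ne_top hp) (ENNReal.rpow_ne_top_of_nonneg
      (div_nonneg hqq.nonneg hqq.symm.nonneg) (maximalConst_ne_top hqq.symm.lt))

theorem NestedFamily.lintegral_rpow_le (hS : NestedFamily S)
    (hm : ∀ Q, MeasurableSet (S Q)) (hμ : ∀ Q, μ (S Q) ≠ ⊤) {b : ι → ℝ≥0∞}
    (hb : ∀ Q, b Q ≠ ⊤) {c : ℝ≥0∞}
    (hc : CarlesonWeight 𝒟 S (c • μ) fun Q => b Q * μ (S Q)) {g : X → ℝ≥0∞} (hg : Measurable g)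
    {p s : ℝ} (hp : 1 < p) (hs : 1 < s) (hgp : ∫⁻ x, g x ^ p ∂μ ≠ ⊤) :
    ∫⁻ x, (∑ Q ∈ 𝒟, (S Q).indicator (fun _ => b Q * setLAvg μ g (S Q) ^ s) x) ^ (p / s) ∂μ
      ≤ embeddingConst p s * c ^ (p / s) * ∫⁻ x, g x ^ p ∂μ := by
  rw [embeddingConst]
  split_ifs with hps
  · exact hS.lintegral_rpow_le_of_le hm hμ hc hg hp hps hgp
  · exact hS.lintegral_rpow_le_of_lt hm hμ hb hc hg hs (not_le.1 hps) hgp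

/-- If the local sums `∑_{Q ⊆ R} b_Q 1_Q` are at most `t` on at least half of every `R`, then
`b` satisfies a Carleson condition with constant `2 t`. -/
theorem NestedFamily.sum_mul_measure_le_of_half (hS : NestedFamily S)
    (hm : ∀ Q, MeasurableSet (S Q)) {b : ι → ℝ≥0∞} {t : ℝ≥0∞}
    (h : ∀ R ∈ 𝒟, μ (S R) ≤ 2 * μ {x ∈ S R |
      ∑ Q ∈ 𝒟.filter (fun Q => S Q ⊆ S R), (S Q).indicator (fun _ => b Q) x ≤ t})
    (R : ι) :
    ∑ Q ∈ 𝒟.filter (fun Q => S Q ⊆ S R), b Q * μ (S Q) ≤ 2 * t * μ (S R) := by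
  set F : ι → X → ℝ≥0∞ := fun R x =>
    ∑ Q ∈ 𝒟.filter (fun Q => S Q ⊆ S R), (S Q).indicator (fun _ => b Q) x with hF
  set E : ι → Set X := fun Q => {x ∈ S Q | F Q x ≤ t} with hE
  have hEm : ∀ Q, MeasurableSet (E Q) := fun Q =>
    (hm Q).inter (measurableSet_le (measurable_sum_indicator hm b) measurable_const)
  have hpt : ∀ x, ∑ Q ∈ 𝒟.filter (fun Q => S Q ⊆ S R), (E Q).indicator (fun _ => b Q) x
      ≤ (S R).indicator (fun _ => t) x := by
    intro x
    set 𝒯 := (𝒟.filter (fun Q => S Q ⊆ S R)).filter (fun Q => x ∈ E Q) with h𝒯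
    have hsum : ∑ Q ∈ 𝒟.filter (fun Q => S Q ⊆ S R), (E Q).indicator (fun _ => b Q) x
        = ∑ Q ∈ 𝒯, b Q := by
      simp only [h𝒯, Finset.sum_filter (fun Q => x ∈ E Q), Set.indicator_apply]
    rw [hsum]
    rcases 𝒯.eq_empty_or_nonempty with h0 | h0
    · simp [h0]
    obtain ⟨𝓜, hsub, hdisj, hcov⟩ := hS.exists_disjoint_cover 𝒯
    have hmem : ∀ Q ∈ 𝒯, Q ∈ 𝒟 ∧ S Q ⊆ S R ∧ x ∈ S Q ∧ F Q x ≤ t := fun Q hQ => by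
      simpa [h𝒯, hE, and_assoc] using hQ
    obtain ⟨P₀, hP₀⟩ := h0
    obtain ⟨P, hP, -⟩ := hcov P₀ hP₀
    obtain ⟨-, hPR, hxP, hPt⟩ := hmem P (hsub hP)
    rw [Set.indicator_of_mem (hPR hxP)]
    refine le_trans ?_ hPt
    have hall : ∀ Q ∈ 𝒯, S Q ⊆ S P := fun Q hQ => by
      obtain ⟨P', hP', hQP'⟩ := hcov Q hQ
      have : P' = P := by
        by_contra hne
        exact Set.disjoint_left.1 (hdisj hP' hP hne) (hmem P' (hsub hP')).2.2.1 hxP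
      exact this ▸ hQP'
    calc ∑ Q ∈ 𝒯, b Q = ∑ Q ∈ 𝒯, (S Q).indicator (fun _ => b Q) x :=
          Finset.sum_congr rfl fun Q hQ => by rw [Set.indicator_of_mem (hmem Q hQ).2.2.1]
      _ ≤ F P x := Finset.sum_le_sum_of_subset fun Q hQ =>
          Finset.mem_filter.2 ⟨(hmem Q hQ).1, hall Q hQ⟩
  calc ∑ Q ∈ 𝒟.filter (fun Q => S Q ⊆ S R), b Q * μ (S Q)
      ≤ ∑ Q ∈ 𝒟.filter (fun Q => S Q ⊆ S R), b Q * (2 * μ (E Q)) :=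
        Finset.sum_le_sum fun Q hQ => mul_le_mul_right (h Q (Finset.mem_filter.1 hQ).1) _
    _ = 2 * ∫⁻ x, ∑ Q ∈ 𝒟.filter (fun Q => S Q ⊆ S R), (E Q).indicator (fun _ => b Q) x ∂μ := by
        rw [lintegral_sum_indicator hEm, Finset.mul_sum]
        exact Finset.sum_congr rfl fun Q _ => mul_left_comm _ _ _
    _ ≤ 2 * ∫⁻ x, (S R).indicator (fun _ => t) x ∂μ := mul_le_mul_right (lintegral_mono hpt) _
    _ = 2 * t * μ (S R) := by rw [lintegral_indicator_const (hm R), mul_assoc]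

end NestedFamily

namespace DCube

variable {d : ℕ}

theorem subset_or_disjoint_of_le {Q R : DCube d} (h : R.k ≤ Q.k) :
    Q.toSet ⊆ R.toSet ∨ Disjoint Q.toSet R.toSet := by
  by_cases hd : Disjoint Q.toSet R.toSet
  · exact Or.inr hd
  obtain ⟨x, hxQ, hxR⟩ := Set.not_disjoint_iff.1 hd
  refine Or.inl fun y hy i => ?_
  obtain ⟨n, hn⟩ := Int.le.dest h
  have hpos : (0:ℝ) < 2 ^ (-Q.k) := by positivity
  have hscale : (2:ℝ) ^ (-R.k) = 2 ^ (-Q.k) * ((2 ^ n : ℤ) : ℝ) := by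
    rw [← hn, neg_add, zpow_add₀ two_ne_zero, mul_assoc, Int.cast_pow, Int.cast_ofNat,
      ← zpow_natCast, ← zpow_add₀ two_ne_zero, neg_add_cancel, zpow_zero, mul_one]
  obtain ⟨hx1, hx2⟩ := hxQ i
  obtain ⟨hx3, hx4⟩ := hxR i
  obtain ⟨hy1, hy2⟩ := hy i
  rw [hscale, mul_assoc] at hx3 hx4 ⊢
  have h1 : 2 ^ n * R.j i ≤ Q.j i := by
    have := lt_of_mul_lt_mul_left (hx3.trans_lt hx2) hpos.le
    exact Int.lt_add_one_iff.1 (by exact_mod_cast this)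
  have h2 : Q.j i + 1 ≤ 2 ^ n * (R.j i + 1) := by
    have := lt_of_mul_lt_mul_left (hx1.trans_lt hx4) hpos.le
    exact Int.add_one_le_iff.2 (by exact_mod_cast this)
  have h1' : ((2 ^ n : ℤ) : ℝ) * R.j i ≤ Q.j i := by exact_mod_cast h1
  have h2' : (Q.j i : ℝ) + 1 ≤ ((2 ^ n : ℤ) : ℝ) * (R.j i + 1) := by exact_mod_cast h2
  exact ⟨(mul_le_mul_of_nonneg_left h1' hpos.le).trans hy1,
    hy2.trans_le (by rw [mul_assoc]; exact mul_le_mul_of_nonneg_left h2' hpos.le)⟩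

theorem nestedFamily_toSet : NestedFamily (toSet : DCube d → Set (Fin d → ℝ)) := by
  intro Q R
  rcases le_total R.k Q.k with h | h
  · rcases subset_or_disjoint_of_le h with h | h
    exacts [Or.inl h, Or.inr (Or.inr h)]
  · rcases subset_or_disjoint_of_le h with h | h
    exacts [Or.inr (Or.inl h), Or.inr (Or.inr h.symm)]

theorem toSet_eq_pi (Q : DCube d) : Q.toSet = Set.univ.pi fun i =>
    Set.Ico ((2:ℝ) ^ (-Q.k) * Q.j i) ((2:ℝ) ^ (-Q.k) * (Q.j i + 1)) := by
  ext x
  simp [toSet]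

theorem measurableSet_toSet (Q : DCube d) : MeasurableSet Q.toSet := by
  rw [toSet_eq_pi]
  exact MeasurableSet.univ_pi fun _ => measurableSet_Ico

theorem measure_toSet_ne_top (μ : Measure (Fin d → ℝ)) [IsLocallyFiniteMeasure μ] (Q : DCube d) :
    μ Q.toSet ≠ ⊤ := by
  have hsub : Q.toSet ⊆ Set.univ.pi fun i =>
      Set.Icc ((2:ℝ) ^ (-Q.k) * Q.j i) ((2:ℝ) ^ (-Q.k) * (Q.j i + 1)) := by
    rw [toSet_eq_pi]
    exact Set.pi_mono fun i _ => Set.Ico_subset_Icc_self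
  exact ((measure_mono hsub).trans_lt
    (isCompact_univ_pi fun _ => isCompact_Icc).measure_lt_top).ne

end DCube

section Embedding

variable {d : ℕ} {μ : Measure (Fin d → ℝ)} {𝒟 : Finset (DCube d)} {β : DCube d → ℝ}

theorem seqNormFn_eq {s : ℝ} (hs : 0 < s) (f : (Fin d → ℝ) → ℝ) (x : Fin d → ℝ) :
    seqNormFn 𝒟 β s μ f x = (∑ Q ∈ 𝒟, Q.toSet.indicator
      (fun _ => ENNReal.ofReal (β Q) * ENNReal.ofReal |cubeAvg μ Q f| ^ s) x) ^ (1 / s) := by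
  rw [seqNormFn]
  congr 1
  refine Finset.sum_congr rfl fun Q _ => ?_
  by_cases hx : x ∈ Q.toSet <;> simp [hx, hs]

theorem TLpNorm_eq {p s : ℝ} (hs : 0 < s) (f : (Fin d → ℝ) → ℝ) :
    TLpNorm 𝒟 β p s μ f = (∫⁻ x, (∑ Q ∈ 𝒟, Q.toSet.indicator (fun _ =>
      ENNReal.ofReal (β Q) * ENNReal.ofReal |cubeAvg μ Q f| ^ s) x) ^ (p / s) ∂μ) ^ (1 / p) := by
  simp only [TLpNorm, seqNormFn_eq hs, ← ENNReal.rpow_mul, one_div_mul_eq_div]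

theorem carlesonWeight_carlConst [IsLocallyFiniteMeasure μ] :
    CarlesonWeight 𝒟 DCube.toSet (carlConst 𝒟 β μ • μ)
      fun Q => ENNReal.ofReal (β Q) * μ Q.toSet := by
  intro R hR
  rw [Measure.smul_apply, smul_eq_mul]
  rcases eq_or_ne (μ R.toSet) 0 with h0 | h0
  · refine (Finset.sum_eq_zero fun Q hQ => ?_).trans_le zero_le
    rw [measure_mono_null (Finset.mem_filter.1 hQ).2 h0, mul_zero]
  · rw [← ENNReal.div_le_iff h0 (R.measure_toSet_ne_top μ), ENNReal.div_eq_inv_mul]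
    exact le_iSup₂ (f := fun (R : DCube d) (_ : R ∈ 𝒟) => (μ R.toSet)⁻¹ *
      ∑ Q ∈ 𝒟.filter (fun Q => Q.toSet ⊆ R.toSet), ENNReal.ofReal (β Q) * μ Q.toSet) R hR

theorem ofReal_abs_cubeAvg_le [IsLocallyFiniteMeasure μ] (Q : DCube d) (f : (Fin d → ℝ) → ℝ) :
    ENNReal.ofReal |cubeAvg μ Q f| ≤ setLAvg μ (fun x => ‖f x‖ₑ) Q.toSet := by
  rw [← Real.enorm_eq_ofReal_abs, cubeAvg, enorm_smul, setLAvg]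
  refine mul_le_mul' ?_ (enorm_integral_le_lintegral_enorm _)
  rw [Real.enorm_eq_ofReal (by positivity)]
  rcases eq_or_ne (μ Q.toSet) 0 with h0 | h0
  · simp [h0]
  · rw [← ENNReal.toReal_inv, ENNReal.ofReal_toReal (ENNReal.inv_ne_top.2 h0)]

/-- A measurable minorant with the same integral over each set of a finite family. -/
theorem exists_measurable_le_forall_setLIntegral_eq {X ι : Type*} [MeasurableSpace X]
    (μ : Measure X) (S : ι → Set X) (𝒟 : Finset ι) (f : X → ℝ≥0∞) :
    ∃ g, Measurable g ∧ g ≤ f ∧ ∀ Q ∈ 𝒟, ∫⁻ x in S Q, g x ∂μ = ∫⁻ x in S Q, f x ∂μ := by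
  choose g hgm hgf hg using fun Q => exists_measurable_le_lintegral_eq (μ.restrict (S Q)) f
  have hle : (fun x => ⨆ Q ∈ 𝒟, g Q x) ≤ f := fun x => iSup₂_le fun Q _ => hgf Q x
  refine ⟨fun x => ⨆ Q ∈ 𝒟, g Q x, Measurable.biSup _ 𝒟.countable_toSet fun Q _ => hgm Q, hle,
    fun Q hQ => (lintegral_mono hle).antisymm ?_⟩
  rw [hg Q]
  exact lintegral_mono fun x => le_iSup₂ (f := fun Q (_ : Q ∈ 𝒟) => g Q x) Q hQ

theorem TLpNorm_le [IsLocallyFiniteMeasure μ] {p s : ℝ} (hp : 1 < p) (hs : 1 < s)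
    (f : (Fin d → ℝ) → ℝ) :
    TLpNorm 𝒟 β p s μ f ≤ (((embeddingConst p s + 1) ^ (s / p)) * carlConst 𝒟 β μ) ^ (1 / s)
      * eLpNorm f (ENNReal.ofReal p) μ := by
  have hp0 : 0 < p := by linarith
  have hs0 : 0 < s := by linarith
  obtain ⟨g, hgm, hgf, hg⟩ := exists_measurable_le_forall_setLIntegral_eq μ DCube.toSet 𝒟
    (fun x => ‖f x‖ₑ)
  set c := carlConst 𝒟 β μ with hc_def
  have hc : CarlesonWeight 𝒟 DCube.toSet (c • μ) fun Q => ENNReal.ofReal (β Q) * μ Q.toSet :=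
    carlesonWeight_carlConst
  have hgG : ∫⁻ x, g x ^ p ∂μ ≤ ∫⁻ x, ‖f x‖ₑ ^ p ∂μ :=
    lintegral_mono fun x => ENNReal.rpow_le_rpow (hgf x) hp0.le
  rw [TLpNorm_eq hs0, eLpNorm_eq_lintegral_rpow_enorm_toReal (by simpa using hp0)
    ENNReal.ofReal_ne_top, ENNReal.toReal_ofReal hp0.le]
  set G := ∫⁻ x, ‖f x‖ₑ ^ p ∂μ
  have hrhs : (((embeddingConst p s + 1) ^ (s / p)) * c) ^ (1 / s) * G ^ (1 / p)
      = ((embeddingConst p s + 1) * c ^ (p / s) * G) ^ (1 / p) := by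
    rw [ENNReal.mul_rpow_of_nonneg _ _ (by positivity),
      ENNReal.mul_rpow_of_nonneg _ _ (by positivity),
      ENNReal.mul_rpow_of_nonneg _ _ (by positivity), ← ENNReal.rpow_mul, ← ENNReal.rpow_mul]
    congr 3 <;> field_simp
  rw [hrhs]
  refine ENNReal.rpow_le_rpow ?_ (by positivity)
  rcases eq_or_ne c 0 with h0 | h0
  · refine le_of_eq_of_le ?_ zero_le
    have hβ : ∀ Q ∈ 𝒟, ENNReal.ofReal (β Q) = 0 ∨ μ Q.toSet = 0 := fun Q hQ => by
      have h1 := hc Q hQ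
      rw [h0, zero_smul, Measure.coe_zero, Pi.zero_apply, nonpos_iff_eq_zero,
        Finset.sum_eq_zero_iff] at h1
      exact mul_eq_zero.1 (h1 Q (Finset.mem_filter.2 ⟨hQ, subset_rfl⟩))
    have hae : ∀ᵐ x ∂μ, ∀ Q ∈ 𝒟, ENNReal.ofReal (β Q) = 0 ∨ x ∉ Q.toSet := by
      rw [Finset.eventually_all]
      intro Q hQ
      rcases hβ Q hQ with h | h
      · exact .of_forall fun _ => Or.inl h
      · filter_upwards [measure_eq_zero_iff_ae_notMem.1 h] with x hx using Or.inr hx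
    rw [← lintegral_zero (μ := μ)]
    refine lintegral_congr_ae ?_
    filter_upwards [hae] with x hx
    rw [Finset.sum_eq_zero, ENNReal.zero_rpow_of_pos (by positivity)]
    intro Q hQ
    rcases hx Q hQ with h | h <;> simp [h]
  rcases eq_or_ne G ⊤ with hG | hG
  · rw [hG, ENNReal.mul_top]
    · exact le_top
    · simp [h0, hp0, hs0, (div_pos hp0 hs0).le]
  calc _ ≤ ∫⁻ x, (∑ Q ∈ 𝒟, Q.toSet.indicator (fun _ =>
          ENNReal.ofReal (β Q) * setLAvg μ g Q.toSet ^ s) x) ^ (p / s) ∂μ := by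
        refine lintegral_mono fun x => ENNReal.rpow_le_rpow ?_ (by positivity)
        refine Finset.sum_le_sum fun Q hQ => Set.indicator_le_indicator ?_
        refine mul_le_mul_right (ENNReal.rpow_le_rpow ?_ hs0.le) _
        rw [setLAvg, hg Q hQ]
        exact ofReal_abs_cubeAvg_le Q f
    _ ≤ embeddingConst p s * c ^ (p / s) * ∫⁻ x, g x ^ p ∂μ :=
        DCube.nestedFamily_toSet.lintegral_rpow_le DCube.measurableSet_toSet
          (DCube.measure_toSet_ne_top μ) (fun _ => ENNReal.ofReal_ne_top) hc hgm hp hs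
          (ne_top_of_le_ne_top hG hgG)
    _ ≤ (embeddingConst p s + 1) * c ^ (p / s) * G := by
        gcongr
        exact le_self_add

theorem ofReal_abs_cubeAvg_one [IsLocallyFiniteMeasure μ] {Q : DCube d} (h0 : μ Q.toSet ≠ 0) :
    ENNReal.ofReal |cubeAvg μ Q fun _ => (1:ℝ)| = 1 := by
  have : (μ Q.toSet).toReal ≠ 0 := ENNReal.toReal_ne_zero.2 ⟨h0, Q.measure_toSet_ne_top μ⟩
  simp [cubeAvg, Measure.real, this]

theorem TLpNorm_filter_one_le [IsLocallyFiniteMeasure μ] {p s : ℝ} {R : DCube d} (hR : R ∈ 𝒟)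
    (h0 : μ R.toSet ≠ 0) :
    TLpNorm (𝒟.filter fun Q => Q.toSet ⊆ R.toSet) β p s μ (fun _ => 1)
      ≤ TtestConst 𝒟 β p s μ * μ R.toSet ^ (1 / p) := by
  have h1 : TLpNorm (𝒟.filter fun Q => Q.toSet ⊆ R.toSet) β p s μ (fun _ => 1)
      * μ R.toSet ^ (-(1 / p)) ≤ TtestConst 𝒟 β p s μ :=
    le_iSup₂ (f := fun (R : DCube d) (_ : R ∈ 𝒟) =>
      TLpNorm (𝒟.filter fun Q => Q.toSet ⊆ R.toSet) β p s μ (fun _ => 1)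
        * μ R.toSet ^ (-(1 / p))) R hR
  refine le_trans (le_of_eq ?_) (mul_le_mul_left h1 _)
  rw [mul_assoc, ← ENNReal.rpow_add _ _ h0 (R.measure_toSet_ne_top μ), neg_add_cancel,
    ENNReal.rpow_zero, mul_one]

theorem carlConst_le_of_TtestConst_lt [IsLocallyFiniteMeasure μ] {p s : ℝ} (hp : 1 < p)
    (hs : 1 < s) {t : ℝ≥0∞} (ht0 : t ≠ 0) (ht : t ≠ ⊤) (hT : 2 * TtestConst 𝒟 β p s μ ≤ t) :
    carlConst 𝒟 β μ ≤ 2 * t ^ s := by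
  have hp0 : 0 < p := by linarith
  have hs0 : 0 < s := by linarith
  set b : DCube d → ℝ≥0∞ := fun Q =>
    ENNReal.ofReal (β Q) * ENNReal.ofReal |cubeAvg μ Q fun _ => (1:ℝ)| ^ s with hb
  have hbμ : ∀ Q : DCube d, ENNReal.ofReal (β Q) * μ Q.toSet = b Q * μ Q.toSet := fun Q => by
    rcases eq_or_ne (μ Q.toSet) 0 with h0 | h0
    · simp [h0]
    · rw [hb]
      simp only [ofReal_abs_cubeAvg_one h0, ENNReal.one_rpow, mul_one]
  have htp0 : t ^ p ≠ 0 := by simp [ht0, ht]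
  have htp : t ^ p ≠ ⊤ := ENNReal.rpow_ne_top_of_nonneg hp0.le ht
  have hhalf : ∀ R ∈ 𝒟, μ R.toSet ≤ 2 * μ {x ∈ R.toSet |
      ∑ Q ∈ 𝒟.filter (fun Q => Q.toSet ⊆ R.toSet), Q.toSet.indicator (fun _ => b Q) x
        ≤ t ^ s} := by
    intro R hR
    rcases eq_or_ne (μ R.toSet) 0 with h0 | h0
    · rw [h0]; exact zero_le
    set F : (Fin d → ℝ) → ℝ≥0∞ := fun x =>
      ∑ Q ∈ 𝒟.filter (fun Q => Q.toSet ⊆ R.toSet), Q.toSet.indicator (fun _ => b Q) x with hF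
    have hFm : Measurable F := measurable_sum_indicator DCube.measurableSet_toSet b
    have hint : ∫⁻ x, F x ^ (p / s) ∂μ ≤ (t / 2) ^ p * μ R.toSet := by
      have h1 := TLpNorm_filter_one_le (β := β) (p := p) (s := s) hR h0
      rw [TLpNorm_eq hs0, one_div, ENNReal.rpow_inv_le_iff hp0,
        ENNReal.mul_rpow_of_nonneg _ _ hp0.le, ← ENNReal.rpow_mul, inv_mul_cancel₀ hp0.ne',
        ENNReal.rpow_one] at h1
      refine h1.trans (mul_le_mul_left (ENNReal.rpow_le_rpow ?_ hp0.le) _)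
      rwa [ENNReal.le_div_iff_mul_le (by simp) (by simp), mul_comm]
    have hbad : 2 * μ {x | t ^ p ≤ F x ^ (p / s)} ≤ μ R.toSet := by
      have h1 := (mul_meas_ge_le_lintegral (μ := μ) (hFm.pow_const (p / s)) (t ^ p)).trans hint
      have h2 : 2 * (t / 2) ^ p ≤ t ^ p := by
        rw [ENNReal.div_rpow_of_nonneg _ _ hp0.le, ← mul_div_assoc]
        refine ENNReal.div_le_of_le_mul' ?_
        gcongr
        exact ENNReal.le_rpow_self_of_one_le one_le_two hp.le
      refine (ENNReal.mul_le_mul_iff_right htp0 htp).1 ?_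
      calc t ^ p * (2 * μ {x | t ^ p ≤ F x ^ (p / s)})
          = 2 * (t ^ p * μ {x | t ^ p ≤ F x ^ (p / s)}) := mul_left_comm _ _ _
        _ ≤ 2 * ((t / 2) ^ p * μ R.toSet) := mul_le_mul_right h1 _
        _ = 2 * (t / 2) ^ p * μ R.toSet := (mul_assoc _ _ _).symm
        _ ≤ t ^ p * μ R.toSet := mul_le_mul_left h2 _
    have hcover : R.toSet ⊆ {x | t ^ p ≤ F x ^ (p / s)} ∪ {x ∈ R.toSet | F x ≤ t ^ s} := by
      intro x hx
      rcases le_total (F x) (t ^ s) with h | h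
      · exact Or.inr ⟨hx, h⟩
      · refine Or.inl ?_
        calc t ^ p = (t ^ s) ^ (p / s) := by rw [← ENNReal.rpow_mul, mul_div_cancel₀ _ hs0.ne']
          _ ≤ F x ^ (p / s) := ENNReal.rpow_le_rpow h (by positivity)
    have hadd : μ R.toSet + μ R.toSet
        ≤ μ R.toSet + 2 * μ {x ∈ R.toSet | F x ≤ t ^ s} := by
      calc μ R.toSet + μ R.toSet = 2 * μ R.toSet := (two_mul _).symm
        _ ≤ 2 * (μ {x | t ^ p ≤ F x ^ (p / s)} + μ {x ∈ R.toSet | F x ≤ t ^ s}) :=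
          mul_le_mul_right ((measure_mono hcover).trans (measure_union_le _ _)) _
        _ ≤ _ := by rw [mul_add]; exact add_le_add_left hbad _
    exact (ENNReal.add_le_add_iff_left (R.measure_toSet_ne_top μ)).1 hadd
  refine iSup₂_le fun R _ => ?_
  rcases eq_or_ne (μ R.toSet) 0 with h0 | h0
  · rw [Finset.sum_eq_zero, mul_zero]
    · exact zero_le
    · intro Q hQ
      rw [measure_mono_null (Finset.mem_filter.1 hQ).2 h0, mul_zero]
  rw [← ENNReal.div_eq_inv_mul, ENNReal.div_le_iff h0 (R.measure_toSet_ne_top μ)]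
  simp only [hbμ]
  exact DCube.nestedFamily_toSet.sum_mul_measure_le_of_half DCube.measurableSet_toSet hhalf R

theorem carlConst_le_TtestConst_rpow [IsLocallyFiniteMeasure μ] {p s : ℝ} (hp : 1 < p)
    (hs : 1 < s) : carlConst 𝒟 β μ ≤ 2 * 2 ^ s * TtestConst 𝒟 β p s μ ^ s := by
  have hs0 : 0 < s := by linarith
  have h1 : (carlConst 𝒟 β μ / 2) ^ s⁻¹ ≤ 2 * TtestConst 𝒟 β p s μ := by
    refine le_of_forall_gt_imp_ge_of_dense fun t ht => ?_
    rcases eq_or_ne t ⊤ with rfl | ht'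
    · exact le_top
    rw [ENNReal.rpow_inv_le_iff hs0]
    exact ENNReal.div_le_of_le_mul'
      (carlConst_le_of_TtestConst_lt hp hs (ne_zero_of_lt ht) ht' ht.le)
  rw [ENNReal.rpow_inv_le_iff hs0, ENNReal.mul_rpow_of_nonneg _ _ hs0.le,
    ENNReal.div_le_iff (by simp) (by simp)] at h1
  exact h1.trans_eq (by ring)

theorem TtestConst_le_of_forall_TLpNorm_le [IsLocallyFiniteMeasure μ] {p s : ℝ} (hp : 0 < p)
    (hs : 0 < s) {N : ℝ≥0∞}
    (hN : ∀ f : (Fin d → ℝ) → ℝ, TLpNorm 𝒟 β p s μ f ≤ N * eLpNorm f (ENNReal.ofReal p) μ) :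
    TtestConst 𝒟 β p s μ ≤ N := by
  refine iSup₂_le fun R _ => ?_
  have hle : TLpNorm (𝒟.filter fun Q => Q.toSet ⊆ R.toSet) β p s μ (fun _ => 1)
      ≤ TLpNorm 𝒟 β p s μ (R.toSet.indicator fun _ => 1) := by
    rw [TLpNorm_eq hs, TLpNorm_eq hs]
    refine ENNReal.rpow_le_rpow (lintegral_mono fun x => ENNReal.rpow_le_rpow ?_ (by positivity))
      (by positivity)
    refine le_of_eq_of_le (Finset.sum_congr rfl fun Q hQ => ?_)
      (Finset.sum_le_sum_of_subset (Finset.filter_subset _ _))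
    have : cubeAvg μ Q (fun _ => (1:ℝ)) = cubeAvg μ Q (R.toSet.indicator fun _ => 1) := by
      rw [cubeAvg, cubeAvg]
      congr 1
      refine setIntegral_congr_fun Q.measurableSet_toSet fun y hy => ?_
      rw [Set.indicator_of_mem ((Finset.mem_filter.1 hQ).2 hy)]
    rw [this]
  have hnorm : eLpNorm (R.toSet.indicator fun _ => (1:ℝ)) (ENNReal.ofReal p) μ
      = μ R.toSet ^ (1 / p) := by
    rw [eLpNorm_indicator_const R.measurableSet_toSet (by simpa using hp) ENNReal.ofReal_ne_top,
      ENNReal.toReal_ofReal hp.le]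
    simp
  calc _ ≤ N * μ R.toSet ^ (1 / p) * μ R.toSet ^ (-(1 / p)) :=
        mul_le_mul_left (hle.trans ((hN _).trans_eq (by rw [hnorm]))) _
    _ ≤ N * 1 := by
        rw [mul_assoc, ENNReal.rpow_neg]
        exact mul_le_mul_right (ENNReal.mul_inv_le_one _) _
    _ = N := mul_one N

end Embedding

/-- **Embedding theorem of Nazarov, Treil, and Volberg.**  Let `μ` be a locally finite Borel
measure on `ℝ^d`, `𝒟` a finite collection of dyadic cubes, and `{β_Q}_{Q ∈ 𝒟}` nonnegative
real numbers, and let `T(fμ) = {⟨f⟩^μ_Q 1_Q}_{Q ∈ 𝒟}`.  Quantitatively: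
(1) for all `1 < p, s < ∞`, `‖T(·μ)‖_{L^p(μ) → L^p_{ℓ^s(𝒟,β)}(μ)}^s ≤ C(p,s) 𝔠`;
(2) for all `1 < s₀ < ∞`, `𝔠 ≤ C(s₀) (𝔗^{p₀}_{s₀})^{s₀}` for every `1 < p₀ < ∞`;
(3) `(𝔗^{s₀}_{s₀})^{s₀} ≤ ‖T(·μ)‖_{L^{s₀}(μ) → L^{s₀}_{ℓ^{s₀}(𝒟,β)}(μ)}^{s₀}`.
In particular the boundedness of `T(·μ) : L^p(μ) → L^p_{ℓ^s(𝒟,β)}(μ)` for some/every choice of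
exponents, the finiteness of some testing constant, and the finiteness of the Carleson
constant are all equivalent. -/
theorem NTV_embedding :
    (∀ p s : ℝ, 1 < p → 1 < s →
      ∃ K : ℝ≥0∞, K ≠ ⊤ ∧
        ∀ (d : ℕ) (μ : Measure (Fin d → ℝ)), IsLocallyFiniteMeasure μ →
          ∀ (𝒟 : Finset (DCube d)) (β : DCube d → ℝ), (∀ Q, 0 ≤ β Q) →
            ∀ f : (Fin d → ℝ) → ℝ,
              TLpNorm 𝒟 β p s μ f
                ≤ (K * carlConst 𝒟 β μ) ^ (1 / s) * eLpNorm f (ENNReal.ofReal p) μ) ∧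
    (∀ s₀ : ℝ, 1 < s₀ →
      ∃ K : ℝ≥0∞, K ≠ ⊤ ∧
        ∀ p₀ : ℝ, 1 < p₀ →
          ∀ (d : ℕ) (μ : Measure (Fin d → ℝ)), IsLocallyFiniteMeasure μ →
            ∀ (𝒟 : Finset (DCube d)) (β : DCube d → ℝ), (∀ Q, 0 ≤ β Q) →
              carlConst 𝒟 β μ ≤ K * TtestConst 𝒟 β p₀ s₀ μ ^ s₀) ∧
    (∀ s₀ : ℝ, 1 < s₀ →
      ∀ (d : ℕ) (μ : Measure (Fin d → ℝ)), IsLocallyFiniteMeasure μ →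
        ∀ (𝒟 : Finset (DCube d)) (β : DCube d → ℝ), (∀ Q, 0 ≤ β Q) →
          ∀ N : ℝ≥0∞,
            (∀ f : (Fin d → ℝ) → ℝ,
              TLpNorm 𝒟 β s₀ s₀ μ f ≤ N * eLpNorm f (ENNReal.ofReal s₀) μ) →
            TtestConst 𝒟 β s₀ s₀ μ ≤ N) := by
  refine ⟨fun p s hp hs => ⟨(embeddingConst p s + 1) ^ (s / p), ?_, ?_⟩,
    fun s hs => ⟨2 * 2 ^ s, ?_, ?_⟩, ?_⟩
  · exact ENNReal.rpow_ne_top_of_nonneg (by positivity)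
      (ENNReal.add_ne_top.2 ⟨embeddingConst_ne_top hp hs, ENNReal.one_ne_top⟩)
  · intro d μ _ 𝒟 β _ f
    exact TLpNorm_le hp hs f
  · exact ENNReal.mul_ne_top ENNReal.ofNat_ne_top
      (ENNReal.rpow_ne_top_of_nonneg (by linarith) ENNReal.ofNat_ne_top)
  · intro p hp d μ _ 𝒟 β _
    exact carlConst_le_TtestConst_rpow hp hs
  · intro s hs d μ _ 𝒟 β _ N hN
    exact TtestConst_le_of_forall_TLpNorm_le (by linarith) (by linarith) hN
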